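/- arXiv:1311.5115 — 2 statements merged into one kernel-verified Lean document; each statement's English description precedes it below -/
import Mathlib

section
/- Fix bus voltages V : Fin n → ℂ, a branch index k, and a bus index i. Then the function t ↦ S_bus(Function.update τ k t, θ)_i has derivative at τ_k equal to (-1/τ_k)·V_i·( 2·conj(Y_ff,k)·(C_f)_{k,i}·conj((C_f·V)_k) + conj(Y_ft,k)·(C_f)_{k,i}·conj((C_t·V)_k) + conj(Y_tf,k)·(C_t)_{k,i}·conj((C_f·V)_k) ). That is, G_τ^s = [V]( C_fᵀ[C_f V*][-2Y_ff*][τ]⁻¹ + C_fᵀ[C_t V*][-Y_ft*][τ]⁻¹ + C_tᵀ[C_f V*][-Y_tf*][τ]⁻¹ ). -/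
open Matrix

noncomputable section

/-- A real matrix viewed as a complex matrix via coercion. -/
def cmat {m n : ℕ} (A : Matrix (Fin m) (Fin n) ℝ) : Matrix (Fin m) (Fin n) ℂ :=
  A.map Complex.ofReal

/-- Y_ff,l(τ,θ) = (y_s,l + i·b_c,l/2)/τ_l². -/
def Yff {m : ℕ} (ys : Fin m → ℂ) (bc : Fin m → ℝ) (τ : Fin m → ℝ) (l : Fin m) : ℂ :=
  (ys l + Complex.I * (bc l : ℂ) / 2) / (τ l : ℂ) ^ 2

/-- Y_ft,l(τ,θ) = -y_s,l·e^{iθ_l}/τ_l. -/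
def Yft {m : ℕ} (ys : Fin m → ℂ) (τ θ : Fin m → ℝ) (l : Fin m) : ℂ :=
  -ys l * Complex.exp (Complex.I * (θ l : ℂ)) / (τ l : ℂ)

/-- Y_tf,l(τ,θ) = -y_s,l·e^{-iθ_l}/τ_l. -/
def Ytf {m : ℕ} (ys : Fin m → ℂ) (τ θ : Fin m → ℝ) (l : Fin m) : ℂ :=
  -ys l * Complex.exp (-(Complex.I * (θ l : ℂ))) / (τ l : ℂ)

/-- Y_tt,l = y_s,l + i·b_c,l/2. -/
def Ytt {m : ℕ} (ys : Fin m → ℂ) (bc : Fin m → ℝ) (l : Fin m) : ℂ :=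
  ys l + Complex.I * (bc l : ℂ) / 2

/-- The bus admittance matrix
Y_bus = C_fᵀ[Y_ff]C_f + C_fᵀ[Y_ft]C_t + C_tᵀ[Y_tf]C_f + C_tᵀ[Y_tt]C_t + [Y_sh]. -/
def Ybus {m n : ℕ} (Cf Ct : Matrix (Fin m) (Fin n) ℝ) (ys : Fin m → ℂ) (bc : Fin m → ℝ)
    (Ysh : Fin n → ℂ) (τ θ : Fin m → ℝ) : Matrix (Fin n) (Fin n) ℂ :=
  (cmat Cf)ᵀ * diagonal (Yff ys bc τ) * cmat Cf
    + (cmat Cf)ᵀ * diagonal (Yft ys τ θ) * cmat Ct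
    + (cmat Ct)ᵀ * diagonal (Ytf ys τ θ) * cmat Cf
    + (cmat Ct)ᵀ * diagonal (Ytt ys bc) * cmat Ct
    + diagonal Ysh

/-- The bus power injection vector S_bus = [V](Y_bus V)*. -/
def Sbus {m n : ℕ} (Cf Ct : Matrix (Fin m) (Fin n) ℝ) (ys : Fin m → ℂ) (bc : Fin m → ℝ)
    (Ysh : Fin n → ℂ) (V : Fin n → ℂ) (τ θ : Fin m → ℝ) (i : Fin n) : ℂ :=
  V i * (starRingEnd ℂ) ((Ybus Cf Ct ys bc Ysh τ θ).mulVec V i)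

/-- Entries of `Aᵀ [d] B V` as a sum over branches. -/
theorem transpose_mul_diagonal_mul_mulVec {m n : ℕ} (A B : Matrix (Fin m) (Fin n) ℂ)
    (d : Fin m → ℂ) (V : Fin n → ℂ) (i : Fin n) :
    (Aᵀ * diagonal d * B).mulVec V i = ∑ l, A l i * d l * B.mulVec V l := by
  rw [← mulVec_mulVec]
  simp [mulVec, dotProduct, mul_diagonal]

/-- If a diagonal `d t` depends on `t` only through its `k`-th entry at first order,
so does each entry of `Aᵀ [d t] B V`. -/
theorem hasDerivAt_transpose_mul_diagonal_mul_mulVec {m n : ℕ} (A B : Matrix (Fin m) (Fin n) ℂ)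
    (V : Fin n → ℂ) (i : Fin n) {d : ℝ → Fin m → ℂ} {d' : ℂ} {k : Fin m} {x : ℝ}
    (hd : HasDerivAt d (Pi.single k d') x) :
    HasDerivAt (fun t => (Aᵀ * diagonal (d t) * B).mulVec V i)
      (A k i * d' * B.mulVec V k) x := by
  simp only [transpose_mul_diagonal_mul_mulVec]
  have h : HasDerivAt (fun t => ∑ l, A l i * d t l * B.mulVec V l)
      (∑ l, A l i * (Pi.single k d' : Fin m → ℂ) l * B.mulVec V l) x :=
    HasDerivAt.fun_sum fun l _ => ((hasDerivAt_pi.1 hd l).const_mul _).mul_const _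
  simpa [Pi.single_apply] using h

/-- A family obtained by applying `g l` to the `l`-th entry of `Function.update τ k t`
varies only in its `k`-th entry. -/
theorem hasDerivAt_comp_update {m : ℕ} (g : Fin m → ℝ → ℂ) (τ : Fin m → ℝ) (k : Fin m) {g' : ℂ}
    (hg : HasDerivAt (g k) g' (τ k)) :
    HasDerivAt (fun t l => g l (Function.update τ k t l)) (Pi.single k g') (τ k) := by
  refine hasDerivAt_pi.2 fun l => ?_
  rcases eq_or_ne l k with rfl | h
  · simpa using hg
  · simpa [h] using hasDerivAt_const (τ k) (g l (τ l))

theorem hasDerivAt_const_div_ofReal (c : ℂ) {x : ℝ} (hx : x ≠ 0) :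
    HasDerivAt (fun t : ℝ => c / (t : ℂ)) (-1 / (x : ℂ) * (c / x)) x := by
  have hx' : (x : ℂ) ≠ 0 := Complex.ofReal_ne_zero.2 hx
  have h := (hasDerivAt_const x c).fun_div (hasDerivAt_id x).ofReal_comp hx'
  refine h.congr_deriv ?_
  simp only [id, Complex.ofReal_one]
  field_simp
  ring

theorem hasDerivAt_const_div_ofReal_sq (c : ℂ) {x : ℝ} (hx : x ≠ 0) :
    HasDerivAt (fun t : ℝ => c / (t : ℂ) ^ 2) (-1 / (x : ℂ) * (2 * (c / (x : ℂ) ^ 2))) x := by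
  have hx' : (x : ℂ) ≠ 0 := Complex.ofReal_ne_zero.2 hx
  have h := (hasDerivAt_const x c).fun_div ((hasDerivAt_id x).ofReal_comp.fun_pow 2)
    (pow_ne_zero 2 hx')
  refine h.congr_deriv ?_
  simp only [id, Complex.ofReal_one]
  field_simp
  ring

theorem hasDerivAt_Yff_update {m : ℕ} (ys : Fin m → ℂ) (bc : Fin m → ℝ) (τ : Fin m → ℝ)
    (k : Fin m) (hk : τ k ≠ 0) :
    HasDerivAt (fun t => Yff ys bc (Function.update τ k t))
      (Pi.single k (-1 / (τ k : ℂ) * (2 * Yff ys bc τ k))) (τ k) :=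
  hasDerivAt_comp_update (fun l t => (ys l + Complex.I * (bc l : ℂ) / 2) / (t : ℂ) ^ 2) τ k
    (hasDerivAt_const_div_ofReal_sq _ hk)

theorem hasDerivAt_Yft_update {m : ℕ} (ys : Fin m → ℂ) (τ θ : Fin m → ℝ)
    (k : Fin m) (hk : τ k ≠ 0) :
    HasDerivAt (fun t => Yft ys (Function.update τ k t) θ)
      (Pi.single k (-1 / (τ k : ℂ) * Yft ys τ θ k)) (τ k) :=
  hasDerivAt_comp_update (fun l t => -ys l * Complex.exp (Complex.I * (θ l : ℂ)) / (t : ℂ)) τ k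
    (hasDerivAt_const_div_ofReal _ hk)

theorem hasDerivAt_Ytf_update {m : ℕ} (ys : Fin m → ℂ) (τ θ : Fin m → ℝ)
    (k : Fin m) (hk : τ k ≠ 0) :
    HasDerivAt (fun t => Ytf ys (Function.update τ k t) θ)
      (Pi.single k (-1 / (τ k : ℂ) * Ytf ys τ θ k)) (τ k) :=
  hasDerivAt_comp_update (fun l t => -ys l * Complex.exp (-(Complex.I * (θ l : ℂ))) / (t : ℂ)) τ k
    (hasDerivAt_const_div_ofReal _ hk)

/-- G_τ^s = [V]( C_fᵀ[C_f V*][-2Y_ff*][τ]⁻¹ + C_fᵀ[C_t V*][-Y_ft*][τ]⁻¹ + C_tᵀ[C_f V*][-Y_tf*][τ]⁻¹ ),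
stated entrywise at bus `i` for the partial derivative in the tap magnitude `τ_k`. -/
theorem Sbus_hasDerivAt_tau {m n : ℕ}
    (Cf Ct : Matrix (Fin m) (Fin n) ℝ) (ys : Fin m → ℂ) (bc : Fin m → ℝ)
    (Ysh : Fin n → ℂ) (τ θ : Fin m → ℝ) (hτ : ∀ l, τ l ≠ 0)
    (V : Fin n → ℂ) (k : Fin m) (i : Fin n) :
    HasDerivAt
      (fun t : ℝ => Sbus Cf Ct ys bc Ysh V (Function.update τ k t) θ i)
      ((-1 / (τ k : ℂ)) * V i *
        (2 * (starRingEnd ℂ) (Yff ys bc τ k) * (Cf k i : ℂ)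
            * (starRingEnd ℂ) ((cmat Cf).mulVec V k)
          + (starRingEnd ℂ) (Yft ys τ θ k) * (Cf k i : ℂ)
            * (starRingEnd ℂ) ((cmat Ct).mulVec V k)
          + (starRingEnd ℂ) (Ytf ys τ θ k) * (Ct k i : ℂ)
            * (starRingEnd ℂ) ((cmat Cf).mulVec V k)))
      (τ k) := by
  have hff := hasDerivAt_transpose_mul_diagonal_mul_mulVec (cmat Cf) (cmat Cf) V i
    (hasDerivAt_Yff_update ys bc τ k (hτ k))
  have hft := hasDerivAt_transpose_mul_diagonal_mul_mulVec (cmat Cf) (cmat Ct) V i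
    (hasDerivAt_Yft_update ys τ θ k (hτ k))
  have htf := hasDerivAt_transpose_mul_diagonal_mul_mulVec (cmat Ct) (cmat Cf) V i
    (hasDerivAt_Ytf_update ys τ θ k (hτ k))
  have h := (((((hff.fun_add hft).fun_add htf).add_const
    (((cmat Ct)ᵀ * diagonal (Ytt ys bc) * cmat Ct).mulVec V i)).add_const
    ((diagonal Ysh).mulVec V i)).star).const_mul (V i)
  simp only [Sbus, Ybus, add_mulVec, Pi.add_apply]
  refine h.congr_deriv ?_
  have hCf : cmat Cf k i = (Cf k i : ℂ) := rfl
  have hCt : cmat Ct k i = (Ct k i : ℂ) := rfl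
  simp only [← starRingEnd_apply, hCf, hCt, map_add, map_mul, map_div₀, map_neg, map_one,
    map_ofNat, Complex.conj_ofReal]
  ring
end
end

section
/- Fix bus voltages V : Fin n → ℂ, a multiplier vector λ : Fin n → ℂ, and branch indices k, l. Let g(τ,θ) = Σ_i λ_i · S_bus(τ,θ)_i. Then the second partial derivative ∂²g/∂θ_k∂θ_l equals 0 if k ≠ l, and for k = l equals −conj(Y_ft,k)·conj((C_t·V)_k)·(C_f·(diag V)·λ)_k − conj(Y_tf,k)·conj((C_f·V)_k)·(C_t·(diag V)·λ)_k. That is, G_θθ^s(λ) = −[C_t V*][C_f[V]λ][Y_ft*] − [C_f V*][C_t[V]λ][Y_tf*]. -/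
open Matrix

noncomputable section

theorem sum_mul_conj_transpose_diagonal_mulVec {m n : ℕ} (A B : Matrix (Fin m) (Fin n) ℝ)
    (y : Fin m → ℂ) (V lam : Fin n → ℂ) :
    ∑ i, lam i * (V i * (starRingEnd ℂ)
        (((cmat A)ᵀ * diagonal y * cmat B).mulVec V i)) =
      ∑ l, (starRingEnd ℂ) (y l) * ((starRingEnd ℂ) ((cmat B).mulVec V l)
        * (cmat A * diagonal V).mulVec lam l) := by
  have h (i : Fin n) : ((cmat A)ᵀ * diagonal y * cmat B).mulVec V i =
      ∑ l, (A l i : ℂ) * (y l * (cmat B).mulVec V l) := by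
    rw [← mulVec_mulVec, ← mulVec_mulVec]
    simp only [mulVec_eq_sum, Finset.sum_apply]
    simp [diagonal_apply, cmat, mul_comm]
  have h' (l : Fin m) : (cmat A * diagonal V).mulVec lam l =
      ∑ i, (A l i : ℂ) * V i * lam i := by
    simp [mulVec, dotProduct, mul_diagonal, cmat]
  simp only [h, h', map_sum, map_mul, Complex.conj_ofReal, Finset.mul_sum]
  rw [Finset.sum_comm]
  refine Finset.sum_congr rfl fun l _ => Finset.sum_congr rfl fun i _ => ?_
  ring

/-- The multiplier-weighted power injection splits into a part independent of the phase shifts and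
a sum over branches, each term depending only on the phase shift of its own branch. -/
theorem sum_mul_Sbus_eq {m n : ℕ} (Cf Ct : Matrix (Fin m) (Fin n) ℝ) (ys : Fin m → ℂ)
    (bc : Fin m → ℝ) (Ysh : Fin n → ℂ) (V lam : Fin n → ℂ) (τ : Fin m → ℝ) :
    ∃ c : ℂ, ∀ θ : Fin m → ℝ, ∑ i, lam i * Sbus Cf Ct ys bc Ysh V τ θ i =
      c + ∑ l, ((starRingEnd ℂ) (Yft ys τ θ l) * ((starRingEnd ℂ) ((cmat Ct).mulVec V l)
          * (cmat Cf * diagonal V).mulVec lam l)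
        + (starRingEnd ℂ) (Ytf ys τ θ l) * ((starRingEnd ℂ) ((cmat Cf).mulVec V l)
          * (cmat Ct * diagonal V).mulVec lam l)) := by
  refine ⟨∑ i, lam i * (V i * (starRingEnd ℂ)
      (((cmat Cf)ᵀ * diagonal (Yff ys bc τ) * cmat Cf
        + (cmat Ct)ᵀ * diagonal (Ytt ys bc) * cmat Ct + diagonal Ysh).mulVec V i)), fun θ => ?_⟩
  rw [Finset.sum_add_distrib, ← sum_mul_conj_transpose_diagonal_mulVec,
    ← sum_mul_conj_transpose_diagonal_mulVec, ← Finset.sum_add_distrib, ← Finset.sum_add_distrib]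
  refine Finset.sum_congr rfl fun i _ => ?_
  simp only [Sbus, Ybus, add_mulVec, Pi.add_apply, map_add]
  ring

theorem hasDerivAt_conj_Yft {m : ℕ} (ys : Fin m → ℂ) (τ θ : Fin m → ℝ) (l : Fin m) (x : ℝ) :
    HasDerivAt (fun t : ℝ => (starRingEnd ℂ) (Yft ys τ (Function.update θ l t) l))
      (-Complex.I * (starRingEnd ℂ) (Yft ys τ (Function.update θ l x) l)) x := by
  have h : HasDerivAt (fun t : ℝ => Yft ys τ (Function.update θ l t) l)
      (Complex.I * Yft ys τ (Function.update θ l x) l) x := by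
    simp only [Yft, Function.update_self]
    refine ((((hasDerivAt_id x).ofReal_comp.const_mul Complex.I).cexp.const_mul
      (-ys l)).div_const (τ l : ℂ)).congr_deriv ?_
    simp only [id, Complex.ofReal_one]
    ring
  simpa using h.star

theorem hasDerivAt_conj_Ytf {m : ℕ} (ys : Fin m → ℂ) (τ θ : Fin m → ℝ) (l : Fin m) (x : ℝ) :
    HasDerivAt (fun t : ℝ => (starRingEnd ℂ) (Ytf ys τ (Function.update θ l t) l))
      (Complex.I * (starRingEnd ℂ) (Ytf ys τ (Function.update θ l x) l)) x := by
  have h : HasDerivAt (fun t : ℝ => Ytf ys τ (Function.update θ l t) l)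
      (-Complex.I * Ytf ys τ (Function.update θ l x) l) x := by
    simp only [Ytf, Function.update_self]
    refine ((((hasDerivAt_id x).ofReal_comp.const_mul Complex.I).neg.cexp.const_mul
      (-ys l)).div_const (τ l : ℂ)).congr_deriv ?_
    simp only [id, Complex.ofReal_one, Pi.neg_apply]
    ring
  simpa using h.star

theorem hasDerivAt_sum_mul_Sbus {m n : ℕ} (Cf Ct : Matrix (Fin m) (Fin n) ℝ) (ys : Fin m → ℂ)
    (bc : Fin m → ℝ) (Ysh : Fin n → ℂ) (V lam : Fin n → ℂ) (τ θ : Fin m → ℝ) (l : Fin m) :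
    HasDerivAt
      (fun t : ℝ => ∑ i, lam i * Sbus Cf Ct ys bc Ysh V τ (Function.update θ l t) i)
      (-Complex.I * (starRingEnd ℂ) (Yft ys τ θ l) * ((starRingEnd ℂ) ((cmat Ct).mulVec V l)
          * (cmat Cf * diagonal V).mulVec lam l)
        + Complex.I * (starRingEnd ℂ) (Ytf ys τ θ l) * ((starRingEnd ℂ) ((cmat Cf).mulVec V l)
          * (cmat Ct * diagonal V).mulVec lam l)) (θ l) := by
  obtain ⟨c, hc⟩ := sum_mul_Sbus_eq Cf Ct ys bc Ysh V lam τ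
  simp only [hc, ← Finset.add_sum_erase _ _ (Finset.mem_univ l), ← add_assoc]
  have hft := hasDerivAt_conj_Yft ys τ θ l (θ l)
  have htf := hasDerivAt_conj_Ytf ys τ θ l (θ l)
  rw [Function.update_eq_self] at hft htf
  have hrest (t : ℝ) : ∑ j ∈ Finset.univ.erase l,
      ((starRingEnd ℂ) (Yft ys τ (Function.update θ l t) j)
          * ((starRingEnd ℂ) ((cmat Ct).mulVec V j) * (cmat Cf * diagonal V).mulVec lam j)
        + (starRingEnd ℂ) (Ytf ys τ (Function.update θ l t) j)
          * ((starRingEnd ℂ) ((cmat Cf).mulVec V j) * (cmat Ct * diagonal V).mulVec lam j)) =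
      ∑ j ∈ Finset.univ.erase l,
      ((starRingEnd ℂ) (Yft ys τ θ j)
          * ((starRingEnd ℂ) ((cmat Ct).mulVec V j) * (cmat Cf * diagonal V).mulVec lam j)
        + (starRingEnd ℂ) (Ytf ys τ θ j)
          * ((starRingEnd ℂ) ((cmat Cf).mulVec V j) * (cmat Ct * diagonal V).mulVec lam j)) :=
    Finset.sum_congr rfl fun j hj => by
      simp only [Yft, Ytf, Function.update_of_ne (Finset.ne_of_mem_erase hj)]
  simp only [hrest]
  exact (((hft.mul_const _).const_add c).add (htf.mul_const _)).add_const _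

/-- G_θθ^s(λ) = −[C_t V*][C_f[V]λ][Y_ft*] − [C_f V*][C_t[V]λ][Y_tf*],
stated entrywise: the iterated partial derivative of g(τ,θ) = Σᵢ λᵢ·S_bus(τ,θ)ᵢ,
first in θ_l, then in θ_k. -/
theorem Sbus_lambda_hasDerivAt_theta_theta {m n : ℕ}
    (Cf Ct : Matrix (Fin m) (Fin n) ℝ) (ys : Fin m → ℂ) (bc : Fin m → ℝ)
    (Ysh : Fin n → ℂ) (τ θ : Fin m → ℝ) (hτ : ∀ l, τ l ≠ 0)
    (V : Fin n → ℂ) (lam : Fin n → ℂ) (k l : Fin m) :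
    HasDerivAt
      (fun s : ℝ =>
        deriv
          (fun t : ℝ => ∑ i, lam i *
            Sbus Cf Ct ys bc Ysh V τ (Function.update (Function.update θ k s) l t) i)
          (Function.update θ k s l))
      (if k = l then
        -((starRingEnd ℂ) (Yft ys τ θ k) * (starRingEnd ℂ) ((cmat Ct).mulVec V k)
            * (cmat Cf * diagonal V).mulVec lam k)
          - (starRingEnd ℂ) (Ytf ys τ θ k) * (starRingEnd ℂ) ((cmat Cf).mulVec V k)
            * (cmat Ct * diagonal V).mulVec lam k
      else 0)
      (θ k) := by
  simp only [(hasDerivAt_sum_mul_Sbus Cf Ct ys bc Ysh V lam τ _ l).deriv]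
  split_ifs with hkl
  · subst hkl
    have hft := hasDerivAt_conj_Yft ys τ θ k (θ k)
    have htf := hasDerivAt_conj_Ytf ys τ θ k (θ k)
    rw [Function.update_eq_self] at hft htf
    refine (((hft.const_mul (-Complex.I)).mul_const _).add
      ((htf.const_mul Complex.I).mul_const _)).congr_deriv ?_
    linear_combination
      ((starRingEnd ℂ) (Yft ys τ θ k) * ((starRingEnd ℂ) ((cmat Ct).mulVec V k)
          * (cmat Cf * diagonal V).mulVec lam k)
        + (starRingEnd ℂ) (Ytf ys τ θ k) * ((starRingEnd ℂ) ((cmat Cf).mulVec V k)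
          * (cmat Ct * diagonal V).mulVec lam k)) * Complex.I_mul_I
  · simp only [Yft, Ytf, Function.update_of_ne (Ne.symm hkl)]
    exact hasDerivAt_const _ _
end
end
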